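/- For every tuple of layers A = (A_i)_{i=0}^{L−1} and every g ∈ G and x ∈ X₀, the multilayer perceptron satisfies Φ_A(ρ₀(g)x) = ρ_L(g) Φ_{ρ̄(g)⁻¹A}(x). -/

import Mathlib

/-- The multilayer perceptron: `x₀ = x`, `x_{i+1} = σ_i (A_i x_i)`, `Φ_A(x) = x_L`. -/
def MLP (X : ℕ → Type*) [∀ i, AddCommGroup (X i)] [∀ i, Module ℝ (X i)]
    (σ : ∀ i : ℕ, X (i + 1) → X (i + 1))
    (A : ∀ i : ℕ, X i →ₗ[ℝ] X (i + 1)) : ∀ n : ℕ, X 0 → X n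
  | 0 => id
  | n + 1 => fun x => σ n (A n (MLP X σ A n x))

/-- For every tuple of layers `A`, every `g ∈ G` and `x ∈ X₀`,
`Φ_A(ρ₀(g)x) = ρ_L(g) Φ_{ρ̄(g)⁻¹A}(x)`, where
`(ρ̄(g)⁻¹A)_i = ρ_{i+1}(g)⁻¹ ∘ A_i ∘ ρ_i(g)`. -/
theorem mlp_transform_input_eq_transform_layers
    {G : Type*} [Group G]
    (X : ℕ → Type*) [∀ i, AddCommGroup (X i)] [∀ i, Module ℝ (X i)]
    [∀ i, FiniteDimensional ℝ (X i)]
    (ρ : ∀ i : ℕ, G →* (X i ≃ₗ[ℝ] X i))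
    (σ : ∀ i : ℕ, X (i + 1) → X (i + 1))
    (hσ : ∀ (i : ℕ) (g : G) (v : X (i + 1)), σ i (ρ (i + 1) g v) = ρ (i + 1) g (σ i v))
    (L : ℕ) (A : ∀ i : ℕ, X i →ₗ[ℝ] X (i + 1)) (g : G) (x : X 0) :
    MLP X σ A L (ρ 0 g x)
      = ρ L g (MLP X σ
          (fun i => ((ρ (i + 1) g)⁻¹).toLinearMap ∘ₗ A i ∘ₗ (ρ i g).toLinearMap)
          L x) := by
  induction L with
  | zero => rfl
  | succ n ih =>
    have apply_inv (y : X (n + 1)) : ρ (n + 1) g ((ρ (n + 1) g)⁻¹ y) = y :=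
      (ρ (n + 1) g).apply_symm_apply y
    simp only [MLP, ih, ← hσ, LinearMap.comp_apply, LinearEquiv.coe_coe, apply_inv]
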